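/- arXiv:2310.17981 — 2 statements merged into one kernel-verified Lean document; each statement's English description precedes it below -/
import Mathlib

section
/- Assume in addition that for all τ, τ' > 0 and all v̄ ∈ V: ‖Φ_τ v̄‖ ≤ c_S ‖v̄‖, ‖π(Φ_τ v̄)‖ ≤ c_S ‖π v̄‖, and ‖π(Φ_τ v̄ − Φ_{τ'} v̄)‖ ≤ c_S |τ − τ'|^β ‖v̄‖; assume moreover the second-order difference bound ‖π(G x₁ − G y₁ − G x₂ + G y₂)‖ ≤ L_G [ (‖ι(x₁−x₂)‖ + ‖ι(y₁−y₂)‖)·‖ι(x₁−y₁)‖ + (‖ι x₂‖ + ‖ι y₂‖)·‖ι(x₁ − y₁ − x₂ + y₂)‖ ] for all x₁, y₁, x₂, y₂ ∈ E. Let v : [0,T] → E be continuous with ‖v‖_{β,ρ,−β} < ∞. Then there exists a constant C, depending only on α and β, such that for all 0 ≤ s < r < t ≤ T, ‖π( D_{s+}^α [τ ↦ Φ_{t−τ}(G(u(τ)) − G(v(τ)))] [r] )‖ ≤ C · c_S · L_G · (1 + ‖u‖_{β,−β} + ‖v‖_{β,−β}) · ‖u − v‖_{β,ρ,−β} ·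 ( (r−s)^{−α} + (r−s)^{β−α} ) · e^{ρ r}. -/
/-- Left-sided Weyl fractional derivative of order `α` with base point `s₀`:
`D_{s₀+}^α Z[r] = (1/Γ(1−α)) ( Z(r)/(r−s₀)^α + α ∫_{s₀}^r (Z(r) − Z(q))/(r−q)^{1+α} dq )`. -/
noncomputable def weylD {V : Type*} [NormedAddCommGroup V] [NormedSpace ℝ V]
    (α s₀ : ℝ) (Z : ℝ → V) (r : ℝ) : V :=
  (Real.Gamma (1 - α))⁻¹ •
    ((((r - s₀) ^ α)⁻¹) • Z r +
      α • ∫ q in s₀..r, (((r - q) ^ (1 + α))⁻¹) • (Z r - Z q))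

/-- The weighted Hölder norm
`‖u‖_{β,ρ,−β} = sup_{t∈[0,T]} e^{−ρ t} ‖u(t)‖
  + sup_{0≤s<t≤T} e^{−ρ t} ‖ι(u(t)) − ι(u(s))‖ / (t−s)^β`. -/
noncomputable def hNorm {E F : Type*} [NormedAddCommGroup E] [NormedSpace ℝ E]
    [NormedAddCommGroup F] [NormedSpace ℝ F]
    (ι : E →L[ℝ] F) (β ρ T : ℝ) (u : ℝ → E) : ℝ :=
  sSup ((fun t => Real.exp (-(ρ * t)) * ‖u t‖) '' Set.Icc 0 T) +
    sSup ((fun p : ℝ × ℝ =>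
        Real.exp (-(ρ * p.2)) * ‖ι (u p.2) - ι (u p.1)‖ / (p.2 - p.1) ^ β) ''
      {p : ℝ × ℝ | 0 ≤ p.1 ∧ p.1 < p.2 ∧ p.2 ≤ T})

/-- Finiteness of the weighted Hölder norm `‖u‖_{β,ρ,−β}`. -/
def hFin {E F : Type*} [NormedAddCommGroup E] [NormedSpace ℝ E]
    [NormedAddCommGroup F] [NormedSpace ℝ F]
    (ι : E →L[ℝ] F) (β ρ T : ℝ) (u : ℝ → E) : Prop :=
  BddAbove ((fun t => Real.exp (-(ρ * t)) * ‖u t‖) '' Set.Icc 0 T) ∧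
    BddAbove ((fun p : ℝ × ℝ =>
        Real.exp (-(ρ * p.2)) * ‖ι (u p.2) - ι (u p.1)‖ / (p.2 - p.1) ^ β) ''
      {p : ℝ × ℝ | 0 ≤ p.1 ∧ p.1 < p.2 ∧ p.2 ≤ T})

open MeasureTheory Set in
/-- A continuous linear map applied to an interval integral is bounded by the integral of any
integrable pointwise majorant of its integrand, whether or not the integrand is integrable. -/
theorem ContinuousLinearMap.norm_apply_intervalIntegral_le
    {V W : Type*} [NormedAddCommGroup V] [NormedSpace ℝ V] [CompleteSpace V]
    [NormedAddCommGroup W] [NormedSpace ℝ W] [CompleteSpace W]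
    (L : V →L[ℝ] W) {f : ℝ → V} {g : ℝ → ℝ} {a b : ℝ} (hab : a ≤ b)
    (hg : IntervalIntegrable g volume a b) (hfg : ∀ x ∈ Ioc a b, ‖L (f x)‖ ≤ g x) :
    ‖L (∫ x in a..b, f x)‖ ≤ ∫ x in a..b, g x := by
  by_cases hf : IntervalIntegrable f volume a b
  · rw [← L.intervalIntegral_comp_comm hf]
    exact intervalIntegral.norm_integral_le_of_norm_le hab
      (Filter.Eventually.of_forall hfg) hg
  · rw [intervalIntegral.integral_undef hf, map_zero, norm_zero,
      intervalIntegral.integral_of_le hab]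
    exact setIntegral_nonneg measurableSet_Ioc fun x hx => (norm_nonneg _).trans (hfg x hx)

/-- A function of finite weighted Hölder norm satisfies the corresponding pointwise growth and
Hölder bounds, with two nonnegative constants that add up to the norm. -/
theorem hFin.exists_bounds {E F : Type*} [NormedAddCommGroup E] [NormedSpace ℝ E]
    [NormedAddCommGroup F] [NormedSpace ℝ F] {ι : E →L[ℝ] F} {β ρ T : ℝ} {u : ℝ → E}
    (h : hFin ι β ρ T u) :
    ∃ A B : ℝ, 0 ≤ A ∧ 0 ≤ B ∧ hNorm ι β ρ T u = A + B ∧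
      (∀ t, 0 ≤ t → t ≤ T → ‖u t‖ ≤ A * Real.exp (ρ * t)) ∧
      ∀ q r, 0 ≤ q → q < r → r ≤ T →
        ‖ι (u r) - ι (u q)‖ ≤ B * Real.exp (ρ * r) * (r - q) ^ β := by
  refine ⟨_, _, Real.sSup_nonneg ?_, Real.sSup_nonneg ?_, rfl, fun t h0 hT => ?_,
    fun q r h0 hqr hT => ?_⟩
  · rintro _ ⟨t, -, rfl⟩
    positivity
  · rintro _ ⟨p, hp, rfl⟩
    have : 0 < p.2 - p.1 := sub_pos.2 hp.2.1
    positivity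
  · have := le_csSup h.1 ⟨t, ⟨h0, hT⟩, rfl⟩
    dsimp only at this
    rwa [Real.exp_neg, inv_mul_le_iff₀ (Real.exp_pos _), mul_comm] at this
  · have := le_csSup h.2 ⟨(q, r), ⟨h0, hqr, hT⟩, rfl⟩
    dsimp only at this
    rw [div_le_iff₀ (Real.rpow_pos_of_pos (sub_pos.2 hqr) β), Real.exp_neg,
      inv_mul_le_iff₀ (Real.exp_pos _)] at this
    exact this.trans_eq (by ring)

open MeasureTheory in
/-- If `Z r` is bounded by `K` and `Z` has `β`-Hölder increments at `r` with constant `K`, both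
measured after applying `L`, then so is its Weyl derivative of order `α < β`, up to a constant. -/
theorem norm_apply_weylD_le {V W : Type*} [NormedAddCommGroup V] [NormedSpace ℝ V]
    [CompleteSpace V] [NormedAddCommGroup W] [NormedSpace ℝ W] [CompleteSpace W]
    (L : V →L[ℝ] W) {α β s r K : ℝ} {Z : ℝ → V} (hα : 0 < α) (hαβ : α < β) (hα1 : α < 1)
    (hsr : s < r) (hK : 0 ≤ K) (hr : ‖L (Z r)‖ ≤ K)
    (hZ : ∀ q, s < q → q < r → ‖L (Z r - Z q)‖ ≤ K * (r - q) ^ β) :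
    ‖L (weylD α s Z r)‖ ≤ (Real.Gamma (1 - α))⁻¹ * (1 + α / (β - α)) * K *
      ((r - s) ^ (-α) + (r - s) ^ (β - α)) := by
  have hΓ : 0 < Real.Gamma (1 - α) := Real.Gamma_pos_of_pos (by linarith)
  have hd : 0 < β - α := sub_pos.2 hαβ
  have hrs : 0 < r - s := sub_pos.2 hsr
  have hint : IntervalIntegrable (fun q => K * (r - q) ^ (β - α - 1)) volume s r := by
    have := (intervalIntegral.intervalIntegrable_rpow' (a := r - s) (b := r - r)
      (r := β - α - 1) (by linarith)).comp_sub_left r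
    simpa using this.const_mul K
  have hval : ∫ q in s..r, K * (r - q) ^ (β - α - 1) = K * ((r - s) ^ (β - α) / (β - α)) := by
    rw [intervalIntegral.integral_const_mul,
      intervalIntegral.integral_comp_sub_left (fun x => x ^ (β - α - 1)) r,
      integral_rpow (Or.inl (by linarith))]
    simp [Real.zero_rpow hd.ne']
  have hI : ‖L (∫ q in s..r, (((r - q) ^ (1 + α))⁻¹) • (Z r - Z q))‖ ≤
      K * ((r - s) ^ (β - α) / (β - α)) := by
    rw [← hval]
    refine L.norm_apply_intervalIntegral_le hsr.le hint fun q hq => ?_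
    rcases hq.2.eq_or_lt with rfl | hqr
    · simp only [sub_self, smul_zero, map_zero, norm_zero]
      positivity
    · have h0 : 0 < r - q := sub_pos.2 hqr
      rw [map_smul, norm_smul, Real.norm_of_nonneg (by positivity),
        show β - α - 1 = β - (1 + α) by ring, Real.rpow_sub h0]
      calc ((r - q) ^ (1 + α))⁻¹ * ‖L (Z r - Z q)‖
          ≤ ((r - q) ^ (1 + α))⁻¹ * (K * (r - q) ^ β) := by
            gcongr
            exact hZ q hq.1 hqr
        _ = _ := by ring
  have hX : 0 < (r - s) ^ (-α) := Real.rpow_pos_of_pos hrs _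
  have hY : 0 < (r - s) ^ (β - α) := Real.rpow_pos_of_pos hrs _
  have hsum : ‖L ((((r - s) ^ α)⁻¹) • Z r +
      α • ∫ q in s..r, (((r - q) ^ (1 + α))⁻¹) • (Z r - Z q))‖ ≤
      (r - s) ^ (-α) * K + α * (K * ((r - s) ^ (β - α) / (β - α))) := by
    rw [map_add, map_smul, map_smul, ← Real.rpow_neg hrs.le]
    refine (norm_add_le _ _).trans ?_
    rw [norm_smul, norm_smul, Real.norm_of_nonneg hX.le, Real.norm_of_nonneg hα.le]
    gcongr
  rw [weylD, map_smul, norm_smul, Real.norm_of_nonneg (by positivity), mul_assoc, mul_assoc]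
  gcongr
  refine hsum.trans ?_
  have h1 : 0 ≤ K * (r - s) ^ (β - α) := by positivity
  have h2 : 0 ≤ α / (β - α) * (K * (r - s) ^ (-α)) := by positivity
  calc _ = K * (r - s) ^ (-α) + α / (β - α) * (K * (r - s) ^ (β - α)) := by ring
    _ ≤ _ := by linarith

/-- Estimate of `‖π(D_{s+}^α [τ ↦ S(t−τ)(G(u(τ))−G(v(τ)))][r])‖` in the
`𝓑_{−β}`-type norm, under the second-order difference bound on `G`: there is a constant
`C = C(α,β)` with bound
`C c_S L_G (1 + ‖u‖_{β,−β} + ‖v‖_{β,−β}) ‖u−v‖_{β,ρ,−β} ((r−s)^{−α} + (r−s)^{β−α}) e^{ρ r}`. -/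
theorem weylD_semigroup_G_difference_bound_minusBeta
    {E F V W : Type*}
    [NormedAddCommGroup E] [NormedSpace ℝ E] [CompleteSpace E]
    [NormedAddCommGroup F] [NormedSpace ℝ F] [CompleteSpace F]
    [NormedAddCommGroup V] [NormedSpace ℝ V] [CompleteSpace V]
    [NormedAddCommGroup W] [NormedSpace ℝ W] [CompleteSpace W]
    (ι : E →L[ℝ] F) (prj : V →L[ℝ] W)
    (hι : ∀ x : E, ‖ι x‖ ≤ ‖x‖) (hprj : ∀ v : V, ‖prj v‖ ≤ ‖v‖)
    (α β : ℝ) (h0α : 0 < α) (hαβ : α < β) (hβ1 : β < 1) :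
    ∃ C : ℝ, 0 < C ∧
      ∀ (cS L_G ρ T : ℝ) (Φ : ℝ → V →L[ℝ] V) (G : E → V) (u v : ℝ → E),
        1 ≤ cS → 0 ≤ L_G → 0 ≤ ρ → 0 < T →
        (∀ w : V, ContinuousOn (fun τ => Φ τ w) (Set.Ioi 0)) →
        (∀ τ : ℝ, 0 < τ → ∀ w : V, ‖Φ τ w‖ ≤ cS * ‖w‖) →
        (∀ τ : ℝ, 0 < τ → ∀ w : V, ‖prj (Φ τ w)‖ ≤ cS * ‖prj w‖) →
        (∀ τ τ' : ℝ, 0 < τ → 0 < τ' → ∀ w : V,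
          ‖prj (Φ τ w - Φ τ' w)‖ ≤ cS * |τ - τ'| ^ β * ‖w‖) →
        G 0 = 0 →
        (∀ x y : E, ‖G x - G y‖ ≤ L_G * ‖x - y‖) →
        (∀ x y : E, ‖prj (G x - G y)‖ ≤ L_G * ‖ι x - ι y‖) →
        (∀ x₁ y₁ x₂ y₂ : E,
          ‖prj (G x₁ - G y₁ - G x₂ + G y₂)‖ ≤
            L_G * ((‖ι (x₁ - x₂)‖ + ‖ι (y₁ - y₂)‖) * ‖ι (x₁ - y₁)‖ +
              (‖ι x₂‖ + ‖ι y₂‖) * ‖ι (x₁ - y₁ - x₂ + y₂)‖)) →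
        ContinuousOn u (Set.Icc 0 T) → ContinuousOn v (Set.Icc 0 T) →
        hFin ι β ρ T u → hFin ι β 0 T u →
        hFin ι β ρ T v → hFin ι β 0 T v →
        hFin ι β ρ T (fun x => u x - v x) →
        ∀ s r t : ℝ, 0 ≤ s → s < r → r < t → t ≤ T →
          ‖prj (weylD α s (fun τ => Φ (t - τ) (G (u τ) - G (v τ))) r)‖ ≤
            C * cS * L_G * (1 + hNorm ι β 0 T u + hNorm ι β 0 T v) *
              hNorm ι β ρ T (fun x => u x - v x) *
              ((r - s) ^ (-α) + (r - s) ^ (β - α)) * Real.exp (ρ * r) := by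
  have hα1 : α < 1 := hαβ.trans hβ1
  have hΓ : 0 < Real.Gamma (1 - α) := Real.Gamma_pos_of_pos (by linarith)
  have hd : 0 < β - α := sub_pos.2 hαβ
  refine ⟨(Real.Gamma (1 - α))⁻¹ * (1 + α / (β - α)), by positivity, ?_⟩
  intro cS L ρ T Φ G u v hcS hL hρ hT _ _ hΦ hΦd _ hG hGι hG2 _ _ _ hu _ hv huv s r t hs hsr hrt htT
  obtain ⟨Au, Bu, hAu, hBu, hNu, hu0, huβ⟩ := hu.exists_bounds
  obtain ⟨Av, Bv, hAv, hBv, hNv, hv0, hvβ⟩ := hv.exists_bounds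
  obtain ⟨A, B, hA, hB, hN, h0, hβ⟩ := huv.exists_bounds
  simp only [zero_mul, Real.exp_zero, mul_one] at hu0 huβ hv0 hvβ
  rw [hNu, hNv, hN]
  have hr0 : 0 ≤ r := by linarith
  have hrT : r ≤ T := by linarith
  set M := 1 + (Au + Bu) + (Av + Bv)
  have hM : 1 ≤ M := by simp only [M]; linarith
  refine (norm_apply_weylD_le (K := cS * L * M * (A + B) * Real.exp (ρ * r)) prj h0α hαβ hα1 hsr
    (by positivity) ?_ fun q hsq hqr => ?_).trans_eq (by ring)
  · calc ‖prj (Φ (t - r) (G (u r) - G (v r)))‖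
        ≤ cS * (L * (A * Real.exp (ρ * r))) := by
          refine (hΦ _ (by linarith) _).trans ?_
          gcongr
          refine (hGι _ _).trans ?_
          gcongr
          rw [← map_sub]
          exact (hι _).trans (h0 r hr0 hrT)
      _ = cS * L * 1 * (A + 0) * Real.exp (ρ * r) := by ring
      _ ≤ _ := by gcongr
  · have hq0 : 0 ≤ q := by linarith
    have hqT : q ≤ T := by linarith
    have hp : 0 < (r - q) ^ β := Real.rpow_pos_of_pos (sub_pos.2 hqr) β
    have hsplit : Φ (t - r) (G (u r) - G (v r)) - Φ (t - q) (G (u q) - G (v q)) =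
        Φ (t - r) (G (u r) - G (v r) - G (u q) + G (v q)) +
          (Φ (t - r) (G (u q) - G (v q)) - Φ (t - q) (G (u q) - G (v q))) := by
      simp only [map_sub, map_add]
      abel
    have hspace : ‖prj (Φ (t - r) (G (u r) - G (v r) - G (u q) + G (v q)))‖ ≤
        cS * (L * ((Bu * (r - q) ^ β + Bv * (r - q) ^ β) * (A * Real.exp (ρ * r)) +
          (Au + Av) * (B * Real.exp (ρ * r) * (r - q) ^ β))) := by
      refine (hΦ _ (by linarith) _).trans ?_
      gcongr
      refine (hG2 _ _ _ _).trans ?_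
      gcongr
      · rw [map_sub]
        exact huβ q r hq0 hqr hrT
      · rw [map_sub]
        exact hvβ q r hq0 hqr hrT
      · exact (hι _).trans (h0 r hr0 hrT)
      · exact (hι _).trans (hu0 q hq0 hqT)
      · exact (hι _).trans (hv0 q hq0 hqT)
      · rw [show u r - v r - u q + v q = (u r - v r) - (u q - v q) by abel, map_sub]
        exact hβ q r hq0 hqr hrT
    have htime : ‖prj (Φ (t - r) (G (u q) - G (v q)) - Φ (t - q) (G (u q) - G (v q)))‖ ≤
        cS * (r - q) ^ β * (L * (A * Real.exp (ρ * r))) := by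
      refine (hΦd _ _ (by linarith) (by linarith) _).trans ?_
      rw [show t - r - (t - q) = -(r - q) by ring, abs_neg, abs_of_pos (sub_pos.2 hqr)]
      gcongr
      refine (hG _ _).trans ?_
      gcongr
      refine (h0 q hq0 hqT).trans ?_
      gcongr
    have hcoef : (Bu + Bv) * A + (Au + Av) * B + A ≤ M * (A + B) := by
      have : M * (A + B) = (Bu + Bv) * A + (Au + Av) * B + A +
          ((Au + Av) * A + (Bu + Bv) * B + B) := by ring
      have : 0 ≤ (Au + Av) * A + (Bu + Bv) * B + B := by positivity
      linarith
    rw [hsplit, map_add]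
    calc _ ≤ _ := (norm_add_le _ _).trans (add_le_add hspace htime)
      _ = cS * L * ((Bu + Bv) * A + (Au + Av) * B + A) * Real.exp (ρ * r) * (r - q) ^ β := by
        ring
      _ ≤ cS * L * (M * (A + B)) * Real.exp (ρ * r) * (r - q) ^ β := by gcongr
      _ = _ := by ring
end

section
/- Assume in addition the semigroup law Φ_{a+b} = Φ_a ∘ Φ_b for all a, b > 0, fix α' with α < α' < 1, and assume for all v̄ ∈ V: ‖Φ_τ v̄‖ ≤ c_S ‖v̄‖ for all τ > 0; ‖Φ_τ v̄‖ ≤ c_S τ^{−β} ‖π v̄‖ for all τ > 0; ‖π(Φ_δ v̄ − v̄)‖ ≤ c_S δ^β ‖v̄‖ for all δ > 0; and ‖Φ_a v̄ − Φ_{a+b} v̄‖ ≤ c_S a^{−α'} b^{α'} ‖v̄‖ for all a, b > 0. Then there exists a constant C, depending only on α, α' and β, such that for all 0 < r < s < t ≤ T, ‖π( D_{0+}^α [τ ↦ Φ_{t−τ}(G(u(τ))) − Φ_{s−τ}(G(u(τ)))] [r] )‖ ≤ C · c_S² · L_G · ‖u‖_{β,ρ,−β} · e^{ρ r} · (t−s)^β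 · ( r^{−α} + (s−r)^{−α'} r^{α'−α} + (s−r)^{−β} r^{β−α} ). -/
theorem intervalIntegrable_sub_rpow {p r : ℝ} (hp : 0 < p) :
    IntervalIntegrable (fun q : ℝ => (r - q) ^ (p - 1)) MeasureTheory.volume 0 r := by
  have h := (intervalIntegral.intervalIntegrable_rpow' (a := 0) (b := r)
    (show -1 < p - 1 by linarith)).comp_sub_left r
  simpa using h.symm

theorem integral_sub_rpow {p r : ℝ} (hp : 0 < p) :
    ∫ q in (0 : ℝ)..r, (r - q) ^ (p - 1) = r ^ p / p := by
  rw [intervalIntegral.integral_comp_sub_left (fun x : ℝ => x ^ (p - 1)) r, sub_self, sub_zero,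
    integral_rpow (Or.inl (by linarith))]
  simp [Real.zero_rpow hp.ne']

/-- A bound for the image of a Weyl derivative under a continuous linear map, when the increments
are controlled by two powers of exponents larger than the order. If the integral in `weylD` does
not converge it vanishes, so no integrability hypothesis is needed. -/
theorem norm_map_weylD_zero_le {V W : Type*} [NormedAddCommGroup V] [NormedSpace ℝ V]
    [CompleteSpace V] [NormedAddCommGroup W] [NormedSpace ℝ W] [CompleteSpace W]
    (L : V →L[ℝ] W) {α a b r A B D : ℝ} (hα : 0 < α) (hα1 : α < 1) (ha : α < a) (hb : α < b)
    (hr : 0 < r) (hB : 0 ≤ B) (hD : 0 ≤ D) {Z : ℝ → V} (hZr : ‖L (Z r)‖ ≤ A)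
    (hZ : ∀ q, 0 < q → q < r → ‖L (Z r - Z q)‖ ≤ B * (r - q) ^ a + D * (r - q) ^ b) :
    ‖L (weylD α 0 Z r)‖ ≤ (Real.Gamma (1 - α))⁻¹ *
      (A * r ^ (-α) + α * (B * (r ^ (a - α) / (a - α)) + D * (r ^ (b - α) / (b - α)))) := by
  have ha' : 0 < a - α := sub_pos.2 ha
  have hb' : 0 < b - α := sub_pos.2 hb
  have hint : ‖L (∫ q in (0 : ℝ)..r, (((r - q) ^ (1 + α))⁻¹) • (Z r - Z q))‖ ≤
      B * (r ^ (a - α) / (a - α)) + D * (r ^ (b - α) / (b - α)) := by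
    by_cases hi : IntervalIntegrable (fun q => (((r - q) ^ (1 + α))⁻¹) • (Z r - Z q)) MeasureTheory.volume 0 r
    · rw [← L.intervalIntegral_comp_comm hi]
      have hIa := (intervalIntegrable_sub_rpow (r := r) ha').const_mul B
      have hIb := (intervalIntegrable_sub_rpow (r := r) hb').const_mul D
      refine (intervalIntegral.norm_integral_le_of_norm_le hr.le (Filter.Eventually.of_forall ?_)
        (hIa.add hIb)).trans_eq ?_
      · rintro q ⟨hq0, hqr⟩
        rcases hqr.eq_or_lt with rfl | hqr
        · simp only [sub_self, smul_zero, map_zero, norm_zero]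
          positivity
        · have hx : 0 < r - q := sub_pos.2 hqr
          rw [map_smul, norm_smul, Real.norm_of_nonneg (by positivity), ← Real.rpow_neg hx.le]
          refine (mul_le_mul_of_nonneg_left (hZ q hq0 hqr) (by positivity)).trans_eq ?_
          rw [show a - α - 1 = -(1 + α) + a by ring, show b - α - 1 = -(1 + α) + b by ring,
            Real.rpow_add hx, Real.rpow_add hx]
          ring
      · rw [intervalIntegral.integral_add hIa hIb, intervalIntegral.integral_const_mul,
          intervalIntegral.integral_const_mul, integral_sub_rpow ha', integral_sub_rpow hb']
    · rw [intervalIntegral.integral_undef hi, map_zero, norm_zero]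
      positivity
  have hΓ : 0 < Real.Gamma (1 - α) := Real.Gamma_pos_of_pos (by linarith)
  rw [weylD, map_smul, norm_smul, Real.norm_of_nonneg (by positivity), map_add, map_smul,
    map_smul, sub_zero, ← Real.rpow_neg hr.le]
  gcongr
  refine (norm_add_le _ _).trans ?_
  rw [norm_smul, norm_smul, Real.norm_of_nonneg (by positivity), Real.norm_of_nonneg hα.le,
    mul_comm A]
  gcongr

theorem sSup_weighted_norm_nonneg {E : Type*} [NormedAddCommGroup E] {ρ T : ℝ} {u : ℝ → E} :
    0 ≤ sSup ((fun t => Real.exp (-(ρ * t)) * ‖u t‖) '' Set.Icc 0 T) := by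
  refine Real.sSup_nonneg ?_
  rintro _ ⟨t, -, rfl⟩
  positivity

section hNorm

variable {E F : Type*} [NormedAddCommGroup E] [NormedSpace ℝ E]
  [NormedAddCommGroup F] [NormedSpace ℝ F] {ι : E →L[ℝ] F} {β ρ T : ℝ} {u : ℝ → E}

theorem sSup_weighted_increment_nonneg :
    0 ≤ sSup ((fun p : ℝ × ℝ =>
        Real.exp (-(ρ * p.2)) * ‖ι (u p.2) - ι (u p.1)‖ / (p.2 - p.1) ^ β) ''
      {p : ℝ × ℝ | 0 ≤ p.1 ∧ p.1 < p.2 ∧ p.2 ≤ T}) := by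
  refine Real.sSup_nonneg ?_
  rintro _ ⟨p, ⟨-, hp, -⟩, rfl⟩
  have : 0 < p.2 - p.1 := sub_pos.2 hp
  positivity

theorem hNorm_nonneg : 0 ≤ hNorm ι β ρ T u :=
  add_nonneg sSup_weighted_norm_nonneg sSup_weighted_increment_nonneg

theorem hFin.norm_le (h : hFin ι β ρ T u) {t : ℝ} (h0 : 0 ≤ t) (hT : t ≤ T) :
    ‖u t‖ ≤ hNorm ι β ρ T u * Real.exp (ρ * t) := by
  have h1 : Real.exp (-(ρ * t)) * ‖u t‖ ≤ hNorm ι β ρ T u :=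
    (le_csSup h.1 ⟨t, ⟨h0, hT⟩, rfl⟩).trans
      (le_add_of_nonneg_right sSup_weighted_increment_nonneg)
  rwa [Real.exp_neg, inv_mul_le_iff₀ (Real.exp_pos _), mul_comm] at h1

theorem hFin.norm_sub_le (h : hFin ι β ρ T u) {q t : ℝ} (h0 : 0 ≤ q) (hqt : q < t)
    (hT : t ≤ T) :
    ‖ι (u t) - ι (u q)‖ ≤ hNorm ι β ρ T u * Real.exp (ρ * t) * (t - q) ^ β := by
  have hx : 0 < t - q := sub_pos.2 hqt
  have h1 : Real.exp (-(ρ * t)) * ‖ι (u t) - ι (u q)‖ / (t - q) ^ β ≤ hNorm ι β ρ T u :=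
    (le_csSup h.2 ⟨(q, t), ⟨h0, hqt, hT⟩, rfl⟩).trans
      (le_add_of_nonneg_left sSup_weighted_norm_nonneg)
  rw [div_le_iff₀ (by positivity), Real.exp_neg, inv_mul_le_iff₀ (Real.exp_pos _)] at h1
  linarith

end hNorm

/-- Estimate of
`‖π(D_{0+}^α [τ ↦ (S(t−τ)−S(s−τ))G(u(τ))][r])‖` for the difference of the semigroup at
two times: there is a constant `C = C(α,α',β)` with bound
`C c_S² L_G ‖u‖_{β,ρ,−β} e^{ρ r} (t−s)^β ( r^{−α} + (s−r)^{−α'} r^{α'−α} + (s−r)^{−β} r^{β−α} )`. -/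
theorem weylD_semigroup_difference_G_bound
    {E F V W : Type*}
    [NormedAddCommGroup E] [NormedSpace ℝ E] [CompleteSpace E]
    [NormedAddCommGroup F] [NormedSpace ℝ F] [CompleteSpace F]
    [NormedAddCommGroup V] [NormedSpace ℝ V] [CompleteSpace V]
    [NormedAddCommGroup W] [NormedSpace ℝ W] [CompleteSpace W]
    (ι : E →L[ℝ] F) (prj : V →L[ℝ] W)
    (hι : ∀ x : E, ‖ι x‖ ≤ ‖x‖) (hprj : ∀ v : V, ‖prj v‖ ≤ ‖v‖)
    (α α' β : ℝ) (h0α : 0 < α) (hαα' : α < α') (hα'1 : α' < 1)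
    (hαβ : α < β) (hβ1 : β < 1) :
    ∃ C : ℝ, 0 < C ∧
      ∀ (cS L_G ρ T : ℝ) (Φ : ℝ → V →L[ℝ] V) (G : E → V) (u : ℝ → E),
        1 ≤ cS → 0 ≤ L_G → 0 ≤ ρ → 0 < T →
        (∀ w : V, ContinuousOn (fun τ => Φ τ w) (Set.Ioi 0)) →
        (∀ a b : ℝ, 0 < a → 0 < b → ∀ w : V, Φ (a + b) w = Φ a (Φ b w)) →
        (∀ τ : ℝ, 0 < τ → ∀ w : V, ‖Φ τ w‖ ≤ cS * ‖w‖) →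
        (∀ τ : ℝ, 0 < τ → ∀ w : V, ‖Φ τ w‖ ≤ cS * τ ^ (-β) * ‖prj w‖) →
        (∀ δ : ℝ, 0 < δ → ∀ w : V, ‖prj (Φ δ w - w)‖ ≤ cS * δ ^ β * ‖w‖) →
        (∀ a b : ℝ, 0 < a → 0 < b → ∀ w : V,
          ‖Φ a w - Φ (a + b) w‖ ≤ cS * a ^ (-α') * b ^ α' * ‖w‖) →
        G 0 = 0 →
        (∀ x y : E, ‖G x - G y‖ ≤ L_G * ‖x - y‖) →
        (∀ x y : E, ‖prj (G x - G y)‖ ≤ L_G * ‖ι x - ι y‖) →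
        ContinuousOn u (Set.Icc 0 T) →
        hFin ι β ρ T u →
        ∀ r s t : ℝ, 0 < r → r < s → s < t → t ≤ T →
          ‖prj (weylD α 0
              (fun τ => Φ (t - τ) (G (u τ)) - Φ (s - τ) (G (u τ))) r)‖ ≤
            C * cS ^ 2 * L_G * hNorm ι β ρ T u * Real.exp (ρ * r) * (t - s) ^ β *
              (r ^ (-α) + (s - r) ^ (-α') * r ^ (α' - α) +
                (s - r) ^ (-β) * r ^ (β - α)) := by
  have hΓ : 0 < Real.Gamma (1 - α) := Real.Gamma_pos_of_pos (by linarith)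
  have hα'α : 0 < α' - α := sub_pos.2 hαα'
  have hβα : 0 < β - α := sub_pos.2 hαβ
  refine ⟨(Real.Gamma (1 - α))⁻¹ * (1 + α / (α' - α) + α / (β - α)), by positivity, ?_⟩
  intro cS L_G ρ T Φ G u hcS hL hρ hT _ hsemi hbd hsmooth hcont hdiff hG0 hGlip hGlip' _ hfin
    r s t hr hrs hst htT
  have hN : 0 ≤ hNorm ι β ρ T u := hNorm_nonneg
  set N := hNorm ι β ρ T u with hNdef
  have hδ : 0 < t - s := sub_pos.2 hst
  have hsr : 0 < s - r := sub_pos.2 hrs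
  have hc0 : 0 ≤ cS := by linarith
  have hg : ∀ q, 0 < q → q ≤ r → ‖G (u q)‖ ≤ L_G * (N * Real.exp (ρ * r)) := by
    intro q hq hqr
    have h1 := hGlip (u q) 0
    rw [hG0, sub_zero, sub_zero] at h1
    refine h1.trans ?_
    gcongr
    refine (hfin.norm_le hq.le (by linarith)).trans ?_
    gcongr
  have hsplit : ∀ q, q ≤ r → Φ (t - q) (G (u q)) - Φ (s - q) (G (u q)) =
      Φ (t - s) (Φ (s - q) (G (u q))) - Φ (s - q) (G (u q)) := by
    intro q hq
    rw [← hsemi _ _ hδ (by linarith), sub_add_sub_cancel]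
  have hincr : ∀ q, 0 < q → q < r → ‖Φ (s - r) (G (u r)) - Φ (s - q) (G (u q))‖ ≤
      cS * (s - r) ^ (-α') * (r - q) ^ α' * (L_G * (N * Real.exp (ρ * r))) +
        cS * (s - r) ^ (-β) * (L_G * (N * Real.exp (ρ * r) * (r - q) ^ β)) := by
    intro q hq hqr
    have hx : 0 < r - q := sub_pos.2 hqr
    have h1 : ‖Φ (s - r) (G (u q)) - Φ (s - q) (G (u q))‖ ≤
        cS * (s - r) ^ (-α') * (r - q) ^ α' * (L_G * (N * Real.exp (ρ * r))) := by
      have h := hdiff (s - r) (r - q) hsr hx (G (u q))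
      rw [sub_add_sub_cancel] at h
      refine h.trans ?_
      gcongr
      exact hg q hq hqr.le
    have h2 : ‖Φ (s - r) (G (u r) - G (u q))‖ ≤
        cS * (s - r) ^ (-β) * (L_G * (N * Real.exp (ρ * r) * (r - q) ^ β)) := by
      refine (hsmooth _ hsr _).trans ?_
      gcongr
      refine (hGlip' _ _).trans ?_
      gcongr
      exact hfin.norm_sub_le hq.le hqr (by linarith)
    rw [show Φ (s - r) (G (u r)) - Φ (s - q) (G (u q)) =
      (Φ (s - r) (G (u q)) - Φ (s - q) (G (u q))) + Φ (s - r) (G (u r) - G (u q)) by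
        rw [map_sub]; abel]
    exact (norm_add_le _ _).trans (add_le_add h1 h2)
  set K := cS ^ 2 * L_G * N * Real.exp (ρ * r) * (t - s) ^ β with hK
  have hK0 : 0 ≤ K := by positivity
  have key := norm_map_weylD_zero_le prj (A := K) (B := K * (s - r) ^ (-α'))
    (D := K * (s - r) ^ (-β)) (Z := fun τ => Φ (t - τ) (G (u τ)) - Φ (s - τ) (G (u τ)))
    h0α (by linarith) hαα' hαβ hr (by positivity) (by positivity)
    (by
      simp only [hsplit r le_rfl]
      refine (hcont _ hδ _).trans ?_
      calc cS * (t - s) ^ β * ‖Φ (s - r) (G (u r))‖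
          ≤ cS * (t - s) ^ β * (cS * (L_G * (N * Real.exp (ρ * r)))) := by
            gcongr
            refine (hbd _ hsr _).trans ?_
            gcongr
            exact hg r hr le_rfl
        _ = K := by rw [hK]; ring)
    (by
      intro q hq hqr
      simp only [hsplit r le_rfl, hsplit q hqr.le]
      rw [sub_sub_sub_comm, ← map_sub]
      refine (hcont _ hδ _).trans ?_
      refine (mul_le_mul_of_nonneg_left (hincr q hq hqr) (by positivity)).trans_eq ?_
      rw [hK]
      ring)
  refine key.trans ?_
  set x := r ^ (-α)
  set y := (s - r) ^ (-α') * r ^ (α' - α) with hy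
  set z := (s - r) ^ (-β) * r ^ (β - α) with hz
  have hx0 : 0 ≤ x := by positivity
  have hy0 : 0 ≤ y := by positivity
  have hz0 : 0 ≤ z := by positivity
  have ha : 0 ≤ α / (α' - α) := by positivity
  have hb : 0 ≤ α / (β - α) := by positivity
  calc _ = (Real.Gamma (1 - α))⁻¹ * K * (1 * x + α / (α' - α) * y + α / (β - α) * z) := by
        rw [hy, hz]; ring
    _ ≤ (Real.Gamma (1 - α))⁻¹ * K * ((1 + α / (α' - α) + α / (β - α)) * (x + y + z)) := by
        gcongr
        nlinarith [mul_nonneg ha hx0, mul_nonneg ha hz0, mul_nonneg hb hx0, mul_nonneg hb hy0]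
    _ = _ := by rw [hK]; ring
end
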